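/- arXiv:2401.11774 — 2 statements merged into one kernel-verified Lean document; each statement's English description precedes it below -/
import Mathlib

section
/- Monotone convergence of the fixed-point SDA iteration started at zero: Assume the sign conditions hold, the kernel condition holds, (A, B) is stabilizable, and (Q − L R⁻¹ Lᵀ, A) is detectable. Suppose X_* ∈ ℝ^{n×n} is symmetric positive semidefinite with 𝓡(X_*) = 0 and is the unique symmetric positive semidefinite solution of 𝓡(X) = 0. Let (X_k)_{k≥0} be symmetric n×n matrices with X_0 = 0 such that for every k ≥ 0: A_c(X_k)ᵀ X_{k+1} + X_{k+1} A_c(X_k) − X_{k+1} G_c(X_k) X_{k+1} + H_c(X_k) = 0 and A_c(X_k) − G_c(X_k) X_{k+1} is stable. Then: (i) for every k ≥ 0, X_k ⪯ X_{k+1}, X_k ⪯ X_*, 𝓡(X_k) ⪰ 0, and A_c(X_k) − G_c(X_k) X_* is stable; (ii) X_k converges to X_* as k → ∞, and every eigenvalue of A_c(X_*) − G_c(X_*) X_*, viewed as a complex matrix, has real part at most 0. -/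
open Matrix Filter

noncomputable section

/-- `Π₁₁(X) = Σᵢ (A₀ⁱ)ᵀ X A₀ⁱ`. -/
def Pi11 {n r : ℕ} (A0 : Fin r → Matrix (Fin n) (Fin n) ℝ)
    (X : Matrix (Fin n) (Fin n) ℝ) : Matrix (Fin n) (Fin n) ℝ :=
  ∑ i, (A0 i)ᵀ * X * A0 i

/-- `Π₁₂(X) = Σᵢ (A₀ⁱ)ᵀ X B₀ⁱ`. -/
def Pi12 {n m r : ℕ} (A0 : Fin r → Matrix (Fin n) (Fin n) ℝ)
    (B0 : Fin r → Matrix (Fin n) (Fin m) ℝ)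
    (X : Matrix (Fin n) (Fin n) ℝ) : Matrix (Fin n) (Fin m) ℝ :=
  ∑ i, (A0 i)ᵀ * X * B0 i

/-- `Π₂₂(X) = Σᵢ (B₀ⁱ)ᵀ X B₀ⁱ`. -/
def Pi22 {n m r : ℕ} (B0 : Fin r → Matrix (Fin n) (Fin m) ℝ)
    (X : Matrix (Fin n) (Fin n) ℝ) : Matrix (Fin m) (Fin m) ℝ :=
  ∑ i, (B0 i)ᵀ * X * B0 i

/-- The block matrix `Π(X) = [Π₁₁(X), Π₁₂(X); Π₁₂(X)ᵀ, Π₂₂(X)]`. -/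
def PiBlock {n m r : ℕ} (A0 : Fin r → Matrix (Fin n) (Fin n) ℝ)
    (B0 : Fin r → Matrix (Fin n) (Fin m) ℝ)
    (X : Matrix (Fin n) (Fin n) ℝ) : Matrix (Fin n ⊕ Fin m) (Fin n ⊕ Fin m) ℝ :=
  fromBlocks (Pi11 A0 X) (Pi12 A0 B0 X) (Pi12 A0 B0 X)ᵀ (Pi22 B0 X)

/-- `L_c(X) = L + Π₁₂(X)`. -/
def Lc {n m r : ℕ} (L : Matrix (Fin n) (Fin m) ℝ)
    (A0 : Fin r → Matrix (Fin n) (Fin n) ℝ) (B0 : Fin r → Matrix (Fin n) (Fin m) ℝ)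
    (X : Matrix (Fin n) (Fin n) ℝ) : Matrix (Fin n) (Fin m) ℝ :=
  L + Pi12 A0 B0 X

/-- `R_c(X) = R + Π₂₂(X)`. -/
def Rc {n m r : ℕ} (R : Matrix (Fin m) (Fin m) ℝ)
    (B0 : Fin r → Matrix (Fin n) (Fin m) ℝ)
    (X : Matrix (Fin n) (Fin n) ℝ) : Matrix (Fin m) (Fin m) ℝ :=
  R + Pi22 B0 X

/-- `Q_c(X) = Q + Π₁₁(X)`. -/
def Qc {n r : ℕ} (Q : Matrix (Fin n) (Fin n) ℝ)
    (A0 : Fin r → Matrix (Fin n) (Fin n) ℝ)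
    (X : Matrix (Fin n) (Fin n) ℝ) : Matrix (Fin n) (Fin n) ℝ :=
  Q + Pi11 A0 X

/-- `A_c(X) = A − B R_c(X)⁻¹ L_c(X)ᵀ`. -/
def Ac {n m r : ℕ} (A : Matrix (Fin n) (Fin n) ℝ) (B : Matrix (Fin n) (Fin m) ℝ)
    (L : Matrix (Fin n) (Fin m) ℝ) (R : Matrix (Fin m) (Fin m) ℝ)
    (A0 : Fin r → Matrix (Fin n) (Fin n) ℝ) (B0 : Fin r → Matrix (Fin n) (Fin m) ℝ)
    (X : Matrix (Fin n) (Fin n) ℝ) : Matrix (Fin n) (Fin n) ℝ :=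
  A - B * (Rc R B0 X)⁻¹ * (Lc L A0 B0 X)ᵀ

/-- `G_c(X) = B R_c(X)⁻¹ Bᵀ`. -/
def Gc {n m r : ℕ} (B : Matrix (Fin n) (Fin m) ℝ) (R : Matrix (Fin m) (Fin m) ℝ)
    (B0 : Fin r → Matrix (Fin n) (Fin m) ℝ)
    (X : Matrix (Fin n) (Fin n) ℝ) : Matrix (Fin n) (Fin n) ℝ :=
  B * (Rc R B0 X)⁻¹ * Bᵀ

/-- `H_c(X) = Q_c(X) − L_c(X) R_c(X)⁻¹ L_c(X)ᵀ`. -/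
def Hc {n m r : ℕ} (Q : Matrix (Fin n) (Fin n) ℝ) (L : Matrix (Fin n) (Fin m) ℝ)
    (R : Matrix (Fin m) (Fin m) ℝ)
    (A0 : Fin r → Matrix (Fin n) (Fin n) ℝ) (B0 : Fin r → Matrix (Fin n) (Fin m) ℝ)
    (X : Matrix (Fin n) (Fin n) ℝ) : Matrix (Fin n) (Fin n) ℝ :=
  Qc Q A0 X - Lc L A0 B0 X * (Rc R B0 X)⁻¹ * (Lc L A0 B0 X)ᵀ

/-- The SCARE residual
`𝓡(X) = AᵀX + XA + Q_c(X) − (XB + L_c(X)) R_c(X)⁻¹ (XB + L_c(X))ᵀ`. -/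
def scareRes {n m r : ℕ} (A : Matrix (Fin n) (Fin n) ℝ) (B : Matrix (Fin n) (Fin m) ℝ)
    (Q : Matrix (Fin n) (Fin n) ℝ) (L : Matrix (Fin n) (Fin m) ℝ)
    (R : Matrix (Fin m) (Fin m) ℝ)
    (A0 : Fin r → Matrix (Fin n) (Fin n) ℝ) (B0 : Fin r → Matrix (Fin n) (Fin m) ℝ)
    (X : Matrix (Fin n) (Fin n) ℝ) : Matrix (Fin n) (Fin n) ℝ :=
  Aᵀ * X + X * A + Qc Q A0 X -
    (X * B + Lc L A0 B0 X) * (Rc R B0 X)⁻¹ * (X * B + Lc L A0 B0 X)ᵀ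

/-- `Ω(X) = [−G_c(X), −A_c(X); −A_c(X)ᵀ, H_c(X)]`. -/
def Omega {n m r : ℕ} (A : Matrix (Fin n) (Fin n) ℝ) (B : Matrix (Fin n) (Fin m) ℝ)
    (Q : Matrix (Fin n) (Fin n) ℝ) (L : Matrix (Fin n) (Fin m) ℝ)
    (R : Matrix (Fin m) (Fin m) ℝ)
    (A0 : Fin r → Matrix (Fin n) (Fin n) ℝ) (B0 : Fin r → Matrix (Fin n) (Fin m) ℝ)
    (X : Matrix (Fin n) (Fin n) ℝ) : Matrix (Fin n ⊕ Fin n) (Fin n ⊕ Fin n) ℝ :=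
  fromBlocks (-(Gc B R B0 X)) (-(Ac A B L R A0 B0 X)) (-(Ac A B L R A0 B0 X))ᵀ
    (Hc Q L R A0 B0 X)

/-- The `2n×n` matrix `[X; −Iₙ]` stacking `X` over `−Iₙ`. -/
def stackNegI {n : ℕ} (X : Matrix (Fin n) (Fin n) ℝ) :
    Matrix (Fin n ⊕ Fin n) (Fin n) ℝ :=
  fromRows X (-1)

/-- The pair `(A, B)` is stabilizable: `yᴴ(A − λI) = 0`, `yᴴB = 0`, `Re λ ≥ 0` imply `y = 0`. -/
def Stabilizable {n m : ℕ} (A : Matrix (Fin n) (Fin n) ℝ)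
    (B : Matrix (Fin n) (Fin m) ℝ) : Prop :=
  ∀ (lam : ℂ) (y : Fin n → ℂ), 0 ≤ lam.re →
    vecMul (star y) (A.map Complex.ofReal - lam • 1) = 0 →
    vecMul (star y) (B.map Complex.ofReal) = 0 → y = 0

/-- The pair `(C, A)` is detectable: `(A − λI)z = 0`, `Cz = 0`, `Re λ ≥ 0` imply `z = 0`. -/
def Detectable {p n : ℕ} (C : Matrix (Fin p) (Fin n) ℝ)
    (A : Matrix (Fin n) (Fin n) ℝ) : Prop :=
  ∀ (lam : ℂ) (z : Fin n → ℂ), 0 ≤ lam.re →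
    mulVec (A.map Complex.ofReal - lam • 1) z = 0 →
    mulVec (C.map Complex.ofReal) z = 0 → z = 0

/-- A real square matrix is stable if all its (complex) eigenvalues have negative real part. -/
def IsStableMatrix {n : ℕ} (M : Matrix (Fin n) (Fin n) ℝ) : Prop :=
  ∀ μ ∈ spectrum ℂ (M.map Complex.ofReal), μ.re < 0

/-- Kernel condition: `(Q − LR⁻¹Lᵀ)z = 0` implies `Lᵀz = 0` and `A₀ⁱ z = 0` for all `i`. -/
def KernelCondition {n m r : ℕ} (Q : Matrix (Fin n) (Fin n) ℝ)
    (L : Matrix (Fin n) (Fin m) ℝ) (R : Matrix (Fin m) (Fin m) ℝ)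
    (A0 : Fin r → Matrix (Fin n) (Fin n) ℝ) : Prop :=
  ∀ z : Fin n → ℂ,
    mulVec ((Q - L * R⁻¹ * Lᵀ).map Complex.ofReal) z = 0 →
    mulVec (Lᵀ.map Complex.ofReal) z = 0 ∧
      ∀ i, mulVec ((A0 i).map Complex.ofReal) z = 0

/-- `Γ(X) = [[0, −A, −B], [−Aᵀ, Q_c(X), L_c(X)], [−Bᵀ, L_c(X)ᵀ, R_c(X)]]`. -/
def Gamma {n m r : ℕ} (A : Matrix (Fin n) (Fin n) ℝ) (B : Matrix (Fin n) (Fin m) ℝ)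
    (Q : Matrix (Fin n) (Fin n) ℝ) (L : Matrix (Fin n) (Fin m) ℝ)
    (R : Matrix (Fin m) (Fin m) ℝ)
    (A0 : Fin r → Matrix (Fin n) (Fin n) ℝ) (B0 : Fin r → Matrix (Fin n) (Fin m) ℝ)
    (X : Matrix (Fin n) (Fin n) ℝ) :
    Matrix ((Fin n ⊕ Fin n) ⊕ Fin m) ((Fin n ⊕ Fin n) ⊕ Fin m) ℝ :=
  fromBlocks (fromBlocks 0 (-A) (-Aᵀ) (Qc Q A0 X))
    (fromRows (-B) (Lc L A0 B0 X))
    (fromRows (-B) (Lc L A0 B0 X))ᵀ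
    (Rc R B0 X)

/-- `F_W(Y) = [Y; −Iₙ]ᵀ (Ω(Y) − Ω(W)) [Y; −Iₙ]`. -/
def FW {n m r : ℕ} (A : Matrix (Fin n) (Fin n) ℝ) (B : Matrix (Fin n) (Fin m) ℝ)
    (Q : Matrix (Fin n) (Fin n) ℝ) (L : Matrix (Fin n) (Fin m) ℝ)
    (R : Matrix (Fin m) (Fin m) ℝ)
    (A0 : Fin r → Matrix (Fin n) (Fin n) ℝ) (B0 : Fin r → Matrix (Fin n) (Fin m) ℝ)
    (W Y : Matrix (Fin n) (Fin n) ℝ) : Matrix (Fin n) (Fin n) ℝ :=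
  (stackNegI Y)ᵀ * (Omega A B Q L R A0 B0 Y - Omega A B Q L R A0 B0 W) * stackNegI Y

/-- `𝓕_W(Z) = Kᵀ Π(Z) K` with `K = [−Iₙ; R_c(W)⁻¹ (L_c(W) + W B)ᵀ]`. -/
def Fcal {n m r : ℕ} (B : Matrix (Fin n) (Fin m) ℝ)
    (L : Matrix (Fin n) (Fin m) ℝ) (R : Matrix (Fin m) (Fin m) ℝ)
    (A0 : Fin r → Matrix (Fin n) (Fin n) ℝ) (B0 : Fin r → Matrix (Fin n) (Fin m) ℝ)
    (W Z : Matrix (Fin n) (Fin n) ℝ) : Matrix (Fin n) (Fin n) ℝ :=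
  (fromRows (-1 : Matrix (Fin n) (Fin n) ℝ)
      ((Rc R B0 W)⁻¹ * (Lc L A0 B0 W + W * B)ᵀ))ᵀ *
    PiBlock A0 B0 Z *
    fromRows (-1 : Matrix (Fin n) (Fin n) ℝ)
      ((Rc R B0 W)⁻¹ * (Lc L A0 B0 W + W * B)ᵀ)

section AuxComplex
open scoped ComplexOrder MatrixOrder
lemma aux_pow_tendsto {E : Type*} [NormedRing E] [NormedAlgebra ℂ E] [CompleteSpace E] [Nontrivial E]
    (a : E) (h : ∀ z ∈ spectrum ℂ a, ‖z‖ < 1) : Tendsto (fun k : ℕ => a ^ k) atTop (nhds 0) := by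
  have h1 : spectralRadius ℂ a < ((1 : NNReal) : ENNReal) :=
    spectrum.spectralRadius_lt_of_forall_lt a (fun z hz => by
      have := h z hz
      exact_mod_cast this)
  obtain ⟨q, hq1, hq2⟩ := ENNReal.lt_iff_exists_nnreal_btwn.1 h1
  have hq2' : q < 1 := by exact_mod_cast hq2
  have h2 := spectrum.pow_nnnorm_pow_one_div_tendsto_nhds_spectralRadius a
  have h3 := h2.eventually_lt_const hq1
  refine squeeze_zero_norm' (a := fun k : ℕ => (q : ℝ) ^ k) ?_
    (tendsto_pow_atTop_nhds_zero_of_lt_one q.2 (by exact_mod_cast hq2'))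
  filter_upwards [h3, eventually_gt_atTop 0] with k hk hk0
  have hk0' : (0 : ℝ) < k := by exact_mod_cast hk0
  have h4 := ENNReal.rpow_le_rpow hk.le hk0'.le
  rw [← ENNReal.rpow_mul, one_div, inv_mul_cancel₀ hk0'.ne', ENNReal.rpow_one,
    ENNReal.rpow_natCast] at h4
  have h5 : ‖a ^ k‖₊ ≤ q ^ k := by exact_mod_cast h4
  exact_mod_cast h5

lemma aux_mem_spectrum {n : ℕ} {M : Matrix (Fin n) (Fin n) ℂ} {μ : ℂ} :
    μ ∈ spectrum ℂ M ↔ ∃ v, v ≠ 0 ∧ M *ᵥ v = μ • v := by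
  rw [← Matrix.spectrum_toLin', ← Module.End.hasEigenvalue_iff_mem_spectrum]
  constructor
  · intro h
    obtain ⟨v, hv⟩ := h.exists_hasEigenvector
    exact ⟨v, hv.2, by simpa using hv.apply_eq_smul⟩
  · rintro ⟨v, hv, h⟩
    exact Module.End.hasEigenvalue_of_hasEigenvector
      (x := v) ⟨Module.End.mem_eigenspace_iff.2 (by simpa using h), hv⟩

lemma aux_mat_pow {n : ℕ} (hn : 0 < n) (a : Matrix (Fin n) (Fin n) ℂ)
    (h : ∀ z ∈ spectrum ℂ a, ‖z‖ < 1) : Tendsto (fun k : ℕ => a ^ k) atTop (nhds 0) := by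
  haveI : Nonempty (Fin n) := ⟨⟨0, hn⟩⟩
  letI := Matrix.linftyOpNormedRing (n := Fin n) (α := ℂ)
  letI := Matrix.linftyOpNormedAlgebra (n := Fin n) (R := ℂ) (α := ℂ)
  exact aux_pow_tendsto a h

/-- Lyapunov. -/
lemma aux_lyap_complex {n : ℕ} (hn : 0 < n) (F D : Matrix (Fin n) (Fin n) ℂ)
    (hF : ∀ μ ∈ spectrum ℂ F, μ.re < 0) (hD : D.IsHermitian)
    (hS : (Fᴴ * D + D * F).PosSemidef) : (-D).PosSemidef := by
  have hinj : ∀ v, (1 - F) *ᵥ v = 0 → v = 0 := by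
    intro v hv
    by_contra hv0
    have := hF 1 (aux_mem_spectrum.2 ⟨v, hv0, by
      rw [sub_mulVec, one_mulVec, sub_eq_zero] at hv
      rw [one_smul]; exact hv.symm⟩)
    norm_num at this
  have hdet : IsUnit (1 - F).det := by
    rw [isUnit_iff_ne_zero]
    intro h0
    obtain ⟨v, hv0, hv⟩ := Matrix.exists_mulVec_eq_zero_iff.2 h0
    exact hv0 (hinj v hv)
  set T := (1 - F)⁻¹ with hT
  have hT1 : (1 - F) * T = 1 := Matrix.mul_nonsing_inv _ hdet
  set C := (1 + F) * T with hC
  have hCs : ∀ z ∈ spectrum ℂ C, ‖z‖ < 1 := by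
    intro z hz
    obtain ⟨y, hy0, hy⟩ := aux_mem_spectrum.1 hz
    set u := T *ᵥ y with hu
    have hyu : y = (1 - F) *ᵥ u := by rw [hu, mulVec_mulVec, hT1, one_mulVec]
    have hu0 : u ≠ 0 := by
      intro h; rw [h, mulVec_zero] at hyu; exact hy0 hyu
    have e1 : (1 + F) *ᵥ u = z • ((1 - F) *ᵥ u) := by
      rw [← hyu, ← hy, hu, mulVec_mulVec, hC]
    rw [add_mulVec, sub_mulVec, one_mulVec] at e1
    have e2 : (z + 1) • (F *ᵥ u) = (z - 1) • u := by
      rw [add_smul, sub_smul, one_smul, one_smul, sub_eq_add_neg]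
      rw [smul_sub] at e1
      have := eq_sub_iff_add_eq.1 e1
      rw [← this]; abel
    have hz1 : z + 1 ≠ 0 := by
      intro h
      have hz : z = -1 := by linear_combination h
      rw [h, zero_smul, hz] at e2
      have := (smul_eq_zero.1 e2.symm).resolve_right hu0
      norm_num at this
    have e3 : F *ᵥ u = ((z - 1) / (z + 1)) • u := by
      rw [div_eq_inv_mul, mul_smul, ← e2, smul_smul, inv_mul_cancel₀ hz1, one_smul]
    have h4 := hF _ (aux_mem_spectrum.2 ⟨u, hu0, e3⟩)
    have h5 : 0 < Complex.normSq (z + 1) := Complex.normSq_pos.2 hz1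
    rw [Complex.div_re, ← add_div, div_neg_iff] at h4
    have h6 : (z - 1).re * (z + 1).re + (z - 1).im * (z + 1).im < 0 := by
      rcases h4 with h | h
      · linarith [h.2]
      · exact h.1
    simp at h6
    have h7 : ‖z‖ ^ 2 < 1 := by
      rw [← Complex.normSq_eq_norm_sq, Complex.normSq_apply]; nlinarith
    nlinarith [norm_nonneg z]
  have hpow := aux_mat_pow hn C hCs
  have hstep : (Cᴴ * D * C - D).PosSemidef := by
    have h1 : (Tᴴ * ((2 : ℝ) • (Fᴴ * D + D * F)) * T).PosSemidef :=
      (hS.smul (by norm_num : (0:ℝ) ≤ 2)).conjTranspose_mul_mul_same T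
    convert h1 using 1
    have h2 : Cᴴ * D * C - D = Cᴴ * D * C - ((1 - F) * T)ᴴ * D * ((1 - F) * T) := by
      rw [hT1]; simp
    have h3 : (2 : ℝ) • (Fᴴ * D + D * F) = (1 + F)ᴴ * D * (1 + F) - (1 - F)ᴴ * D * (1 - F) := by
      rw [two_smul]
      simp only [conjTranspose_add, conjTranspose_sub, conjTranspose_one]
      noncomm_ring
    rw [h2, h3, hC]
    simp only [conjTranspose_mul]
    noncomm_ring
  have hk : ∀ k : ℕ, ((C ^ k)ᴴ * D * C ^ k - D).PosSemidef := by
    intro k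
    induction k with
    | zero => simpa using PosSemidef.zero
    | succ k ih =>
      have h1 := (hstep.conjTranspose_mul_mul_same (C ^ k)).add ih
      convert h1 using 1
      rw [pow_succ', conjTranspose_mul]
      noncomm_ring
  refine .of_dotProduct_mulVec_nonneg hD.neg fun x => ?_
  have hlim : Tendsto (fun k : ℕ => star x ⬝ᵥ (((C ^ k)ᴴ * D * C ^ k - D) *ᵥ x)) atTop
      (nhds (star x ⬝ᵥ (((0 : Matrix (Fin n) (Fin n) ℂ)ᴴ * D * 0 - D) *ᵥ x))) := by
    have hc : Continuous (fun M : Matrix (Fin n) (Fin n) ℂ =>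
      star x ⬝ᵥ ((Mᴴ * D * M - D) *ᵥ x)) := by fun_prop
    exact (hc.tendsto 0).comp hpow
  have := ge_of_tendsto' hlim (fun k => (hk k).dotProduct_mulVec_nonneg x)
  simpa using this

lemma aux_map_psd {n : ℕ} {M : Matrix (Fin n) (Fin n) ℝ} (h : M.PosSemidef) :
    (M.map Complex.ofReal).PosSemidef := by

  obtain ⟨C, rfl⟩ := CStarAlgebra.nonneg_iff_eq_star_mul_self.1 h.nonneg
  have : ((star C * C).map Complex.ofReal) = (C.map Complex.ofReal)ᴴ * (C.map Complex.ofReal) := by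
    ext i j
    simp [Matrix.mul_apply, star_eq_conjTranspose]
  rw [this]
  exact posSemidef_conjTranspose_mul_self _

lemma aux_psd_of_map {n : ℕ} {M : Matrix (Fin n) (Fin n) ℝ} (hM : M.IsHermitian)
    (h : (M.map Complex.ofReal).PosSemidef) : M.PosSemidef := by
  refine .of_dotProduct_mulVec_nonneg hM fun x => ?_
  have h1 := h.dotProduct_mulVec_nonneg (fun i => (x i : ℂ))
  have h2 : star (fun i => (x i : ℂ)) ⬝ᵥ ((M.map Complex.ofReal) *ᵥ (fun i => (x i : ℂ)))
      = ((star x ⬝ᵥ (M *ᵥ x) : ℝ) : ℂ) := by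
    simp [dotProduct, mulVec]
  rw [h2] at h1
  exact_mod_cast h1

lemma aux_map_mul {a b c : ℕ} (M : Matrix (Fin a) (Fin b) ℝ) (N : Matrix (Fin b) (Fin c) ℝ) :
    (M * N).map Complex.ofReal = M.map Complex.ofReal * N.map Complex.ofReal := by
  ext i j; simp [Matrix.mul_apply]

lemma aux_map_add {a b : ℕ} (M N : Matrix (Fin a) (Fin b) ℝ) :
    (M + N).map Complex.ofReal = M.map Complex.ofReal + N.map Complex.ofReal := by
  ext i j; simp

lemma aux_map_sub {a b : ℕ} (M N : Matrix (Fin a) (Fin b) ℝ) :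
    (M - N).map Complex.ofReal = M.map Complex.ofReal - N.map Complex.ofReal := by
  ext i j; simp

lemma aux_map_transpose {a b : ℕ} (M : Matrix (Fin a) (Fin b) ℝ) :
    Mᵀ.map Complex.ofReal = (M.map Complex.ofReal)ᴴ := by
  ext i j; simp

end AuxComplex

lemma aux_lyap {n : ℕ} (hn : 0 < n) (F D : Matrix (Fin n) (Fin n) ℝ)
    (hF : IsStableMatrix F) (hD : D.IsHermitian)
    (hS : (Fᵀ * D + D * F).PosSemidef) : (-D).PosSemidef := by
  refine aux_psd_of_map hD.neg ?_
  have h := aux_map_psd hS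
  rw [aux_map_add, aux_map_mul, aux_map_mul, aux_map_transpose] at h
  open scoped ComplexOrder in
  have h2 := aux_lyap_complex hn (F.map Complex.ofReal) (D.map Complex.ofReal) hF
    (by rw [IsHermitian, ← aux_map_transpose, ← conjTranspose_eq_transpose_of_trivial, hD.eq]) h
  convert h2 using 1
  ext i j; simp

lemma aux_symm_transpose {n : ℕ} {M : Matrix (Fin n) (Fin n) ℝ} (h : M.IsHermitian) : Mᵀ = M := by
  rw [← conjTranspose_eq_transpose_of_trivial]; exact h

lemma aux_herm {n : ℕ} {M : Matrix (Fin n) (Fin n) ℝ} (h : Mᵀ = M) : M.IsHermitian := by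
  rw [IsHermitian, conjTranspose_eq_transpose_of_trivial]; exact h

lemma aux_congr_psd {a b : ℕ} {M : Matrix (Fin a) (Fin a) ℝ} (h : M.PosSemidef)
    (K : Matrix (Fin a) (Fin b) ℝ) : (Kᵀ * M * K).PosSemidef := by
  have := h.conjTranspose_mul_mul_same K
  rwa [conjTranspose_eq_transpose_of_trivial] at this

/-- The Riccati operator with weights `Q`, `L`, `R`. -/
def auxRic {n m : ℕ} (A : Matrix (Fin n) (Fin n) ℝ) (B : Matrix (Fin n) (Fin m) ℝ)
    (Q : Matrix (Fin n) (Fin n) ℝ) (L : Matrix (Fin n) (Fin m) ℝ)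
    (R : Matrix (Fin m) (Fin m) ℝ) (X : Matrix (Fin n) (Fin n) ℝ) : Matrix (Fin n) (Fin n) ℝ :=
  Aᵀ * X + X * A + Q - (X * B + L) * R⁻¹ * (X * B + L)ᵀ

/-- The Lyapunov operator associated with a feedback gain `K`. -/
def auxPhi {n m : ℕ} (A : Matrix (Fin n) (Fin n) ℝ) (B : Matrix (Fin n) (Fin m) ℝ)
    (Q : Matrix (Fin n) (Fin n) ℝ) (L : Matrix (Fin n) (Fin m) ℝ)
    (R : Matrix (Fin m) (Fin m) ℝ) (X : Matrix (Fin n) (Fin n) ℝ)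
    (K : Matrix (Fin m) (Fin n) ℝ) : Matrix (Fin n) (Fin n) ℝ :=
  (A + B * K)ᵀ * X + X * (A + B * K) + Q + L * K + Kᵀ * Lᵀ + Kᵀ * R * K

lemma aux_square {n m : ℕ} (A : Matrix (Fin n) (Fin n) ℝ) (B : Matrix (Fin n) (Fin m) ℝ)
    (Q : Matrix (Fin n) (Fin n) ℝ) (L : Matrix (Fin n) (Fin m) ℝ)
    (R : Matrix (Fin m) (Fin m) ℝ) (X : Matrix (Fin n) (Fin n) ℝ) (hR : R.PosDef) (hX : Xᵀ = X)
    (K : Matrix (Fin m) (Fin n) ℝ) :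
    auxPhi A B Q L R X K = auxRic A B Q L R X +
      (K + R⁻¹ * (X * B + L)ᵀ)ᵀ * R * (K + R⁻¹ * (X * B + L)ᵀ) := by
  have hdet : IsUnit R.det := hR.det_pos.ne'.isUnit
  have h1 : ∀ M : Matrix (Fin m) (Fin n) ℝ, R * (R⁻¹ * M) = M := fun M =>
    Matrix.mul_nonsing_inv_cancel_left _ _ hdet
  have h2 : ∀ M : Matrix (Fin m) (Fin n) ℝ, R⁻¹ * (R * M) = M := fun M =>
    Matrix.nonsing_inv_mul_cancel_left _ _ hdet
  have hS : (R⁻¹)ᵀ = R⁻¹ := by rw [transpose_nonsing_inv, aux_symm_transpose hR.1]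
  simp only [auxPhi, auxRic, transpose_add, transpose_mul, hX, hS, Matrix.mul_add, Matrix.add_mul,
    Matrix.mul_assoc, h1, h2, transpose_transpose]
  abel

section
variable {n m r : ℕ} (A : Matrix (Fin n) (Fin n) ℝ) (B : Matrix (Fin n) (Fin m) ℝ)
    (Q : Matrix (Fin n) (Fin n) ℝ) (L : Matrix (Fin n) (Fin m) ℝ)
    (R : Matrix (Fin m) (Fin m) ℝ)
    (A0 : Fin r → Matrix (Fin n) (Fin n) ℝ) (B0 : Fin r → Matrix (Fin n) (Fin m) ℝ)

lemma aux_Rc_posDef (hR : R.PosDef) {W : Matrix (Fin n) (Fin n) ℝ} (hW : W.PosSemidef) :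
    (Rc R B0 W).PosDef := by
  refine hR.add_posSemidef ?_
  exact posSemidef_sum _ fun i _ => aux_congr_psd hW _

lemma aux_Lc_transpose {W : Matrix (Fin n) (Fin n) ℝ} (hW : Wᵀ = W) :
    (Lc L A0 B0 W)ᵀ = Lᵀ + ∑ i, (B0 i)ᵀ * W * A0 i := by
  simp only [Lc, Pi12, transpose_add, transpose_sum, transpose_mul, transpose_transpose, hW,
    Matrix.mul_assoc]

lemma aux_Phi_diff (X : Matrix (Fin n) (Fin n) ℝ) (K : Matrix (Fin m) (Fin n) ℝ)
    {W V : Matrix (Fin n) (Fin n) ℝ} (hW : Wᵀ = W) (hV : Vᵀ = V) :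
    auxPhi A B (Qc Q A0 W) (Lc L A0 B0 W) (Rc R B0 W) X K =
    auxPhi A B (Qc Q A0 V) (Lc L A0 B0 V) (Rc R B0 V) X K +
      ∑ i, (A0 i + B0 i * K)ᵀ * (W - V) * (A0 i + B0 i * K) := by
  simp only [auxPhi, aux_Lc_transpose _ _ _ hW, aux_Lc_transpose _ _ _ hV]
  simp only [Qc, Lc, Rc, Pi11, Pi12, Pi22, Matrix.add_mul, Matrix.mul_add, Matrix.sum_mul,
    Matrix.mul_sum, Matrix.sub_mul, Matrix.mul_sub, transpose_add, transpose_mul,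
    Matrix.mul_assoc, Finset.sum_add_distrib, Finset.sum_sub_distrib]
  abel

lemma aux_mono (hR : R.PosDef) {W V X : Matrix (Fin n) (Fin n) ℝ} (hV : V.PosSemidef)
    (hW : W.PosSemidef) (hWV : (W - V).PosSemidef) (hX : Xᵀ = X) :
    (auxRic A B (Qc Q A0 W) (Lc L A0 B0 W) (Rc R B0 W) X -
      auxRic A B (Qc Q A0 V) (Lc L A0 B0 V) (Rc R B0 V) X).PosSemidef := by
  set K := -((Rc R B0 W)⁻¹ * (X * B + Lc L A0 B0 W)ᵀ) with hK
  have h1 := aux_square A B (Qc Q A0 W) (Lc L A0 B0 W) (Rc R B0 W) X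
    (aux_Rc_posDef R B0 hR hW) hX K
  have h2 := aux_square A B (Qc Q A0 V) (Lc L A0 B0 V) (Rc R B0 V) X
    (aux_Rc_posDef R B0 hR hV) hX K
  have h3 := aux_Phi_diff A B Q L R A0 B0 X K (aux_symm_transpose hW.1) (aux_symm_transpose hV.1)
  have h4 : K + (Rc R B0 W)⁻¹ * (X * B + Lc L A0 B0 W)ᵀ = 0 := by rw [hK]; simp
  rw [h4, Matrix.mul_zero, add_zero] at h1
  have h5 : (∑ i, (A0 i + B0 i * K)ᵀ * (W - V) * (A0 i + B0 i * K)).PosSemidef :=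
    posSemidef_sum _ fun i _ => aux_congr_psd hWV _
  have h6 := aux_congr_psd (aux_Rc_posDef R B0 hR hV).posSemidef
    (K + (Rc R B0 V)⁻¹ * (X * B + Lc L A0 B0 V)ᵀ)
  convert h6.add h5 using 1
  rw [← h1, h3, h2]
  abel

lemma aux_Rinv_symm (hR : R.PosDef) {W : Matrix (Fin n) (Fin n) ℝ} (hW : W.PosSemidef) :
    ((Rc R B0 W)⁻¹)ᵀ = (Rc R B0 W)⁻¹ := by
  rw [transpose_nonsing_inv, aux_symm_transpose (aux_Rc_posDef R B0 hR hW).1]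

lemma aux_ric_eq (hR : R.PosDef) {W X : Matrix (Fin n) (Fin n) ℝ} (hW : W.PosSemidef)
    (hX : Xᵀ = X) :
    auxRic A B (Qc Q A0 W) (Lc L A0 B0 W) (Rc R B0 W) X =
    (Ac A B L R A0 B0 W)ᵀ * X + X * Ac A B L R A0 B0 W - X * Gc B R B0 W * X +
      Hc Q L R A0 B0 W := by
  have hS := aux_Rinv_symm R B0 hR hW
  simp only [auxRic, Ac, Gc, Hc, transpose_add, transpose_sub, transpose_mul, transpose_transpose,
    hX, hS, Matrix.mul_add, Matrix.add_mul, Matrix.mul_sub, Matrix.sub_mul, Matrix.mul_assoc]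
  abel

lemma aux_Gc_symm (hR : R.PosDef) {W : Matrix (Fin n) (Fin n) ℝ} (hW : W.PosSemidef) :
    (Gc B R B0 W)ᵀ = Gc B R B0 W := by
  simp only [Gc, transpose_mul, transpose_transpose, aux_Rinv_symm R B0 hR hW, Matrix.mul_assoc]

lemma aux_DGD (hR : R.PosDef) {W D : Matrix (Fin n) (Fin n) ℝ} (hW : W.PosSemidef)
    (hD : Dᵀ = D) : (D * Gc B R B0 W * D).PosSemidef := by
  have := aux_congr_psd (aux_Rc_posDef R B0 hR hW).posSemidef.inv (Bᵀ * D)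
  convert this using 1
  simp only [Gc, transpose_mul, transpose_transpose, hD, Matrix.mul_assoc]

/-- Difference of two Riccati values, recentred at `X`. -/
lemma aux_shift (M G H X Y : Matrix (Fin n) (Fin n) ℝ) (hG : Gᵀ = G) (hX : Xᵀ = X) :
    (M - G * X)ᵀ * (Y - X) + (Y - X) * (M - G * X) =
      (Mᵀ * Y + Y * M - Y * G * Y + H) - (Mᵀ * X + X * M - X * G * X + H) +
        (Y - X) * G * (Y - X) := by
  simp only [transpose_sub, transpose_mul, hG, hX]
  noncomm_ring

lemma aux_compare (hn : 0 < n) (hR : R.PosDef) {W X Y : Matrix (Fin n) (Fin n) ℝ}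
    (hW : W.PosSemidef) (hX : Xᵀ = X) (hY : Yᵀ = Y)
    (hst : IsStableMatrix (Ac A B L R A0 B0 W - Gc B R B0 W * X))
    (h : (auxRic A B (Qc Q A0 W) (Lc L A0 B0 W) (Rc R B0 W) Y -
      auxRic A B (Qc Q A0 W) (Lc L A0 B0 W) (Rc R B0 W) X).PosSemidef) :
    (X - Y).PosSemidef := by
  have hD : (Y - X)ᵀ = Y - X := by rw [transpose_sub, hX, hY]
  have h1 := aux_lyap hn _ (Y - X) hst (aux_herm hD) (by
    rw [aux_shift _ _ (Hc Q L R A0 B0 W) X Y (aux_Gc_symm B R B0 hR hW) hX,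
      ← aux_ric_eq A B Q L R A0 B0 hR hW hY, ← aux_ric_eq A B Q L R A0 B0 hR hW hX]
    exact h.add (aux_DGD B R B0 hR hW hD))
  rwa [neg_sub] at h1

lemma aux_map_sum {a b : ℕ} (M : Fin r → Matrix (Fin a) (Fin b) ℝ) :
    (∑ i, M i).map Complex.ofReal = ∑ i, (M i).map Complex.ofReal := by
  ext i j; simp [Matrix.sum_apply]

open scoped ComplexOrder in
lemma aux_quad_re {n : ℕ} {M : Matrix (Fin n) (Fin n) ℝ} (hM : M.PosSemidef) (z : Fin n → ℂ) :
    0 ≤ (star z ⬝ᵥ (M.map Complex.ofReal *ᵥ z)).re ∧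
    ((star z ⬝ᵥ (M.map Complex.ofReal *ᵥ z)).re = 0 → M.map Complex.ofReal *ᵥ z = 0) := by
  have h := aux_map_psd hM
  have h1 := Complex.nonneg_iff.1 (h.dotProduct_mulVec_nonneg z)
  refine ⟨h1.1, fun h2 => (h.dotProduct_mulVec_zero_iff z).1 ?_⟩
  exact Complex.ext h2 h1.2.symm

lemma aux_H0 (hR : R.PosDef) (hsign : (fromBlocks Q L Lᵀ R).PosSemidef) :
    (Q - L * R⁻¹ * Lᵀ).PosSemidef := by
  letI : Invertible R := Matrix.invertibleOfIsUnitDet _ hR.det_pos.ne'.isUnit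
  have := (Matrix.PosDef.fromBlocks₂₂ (A := Q) (B := L) (D := R) hR).1 (by
    rwa [conjTranspose_eq_transpose_of_trivial])
  rwa [conjTranspose_eq_transpose_of_trivial] at this

lemma aux_Hc_zero : Hc Q L R A0 B0 0 = Q - L * R⁻¹ * Lᵀ := by
  simp [Hc, Qc, Lc, Rc, Pi11, Pi12, Pi22]

lemma aux_ric_zero (W : Matrix (Fin n) (Fin n) ℝ) :
    auxRic A B (Qc Q A0 W) (Lc L A0 B0 W) (Rc R B0 W) 0 = Hc Q L R A0 B0 W := by
  simp [auxRic, Hc]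

lemma aux_stab (hR : R.PosDef) (hsign : (fromBlocks Q L Lᵀ R).PosSemidef)
    (hker : KernelCondition Q L R A0) (hdet : Detectable (Q - L * R⁻¹ * Lᵀ) A)
    {W X : Matrix (Fin n) (Fin n) ℝ} (hW : W.PosSemidef) (hX : X.PosSemidef)
    (hric : (-(auxRic A B (Qc Q A0 W) (Lc L A0 B0 W) (Rc R B0 W) X)).PosSemidef) :
    IsStableMatrix (Ac A B L R A0 B0 W - Gc B R B0 W * X) := by
  intro μ hμ
  obtain ⟨z, hz0, hz⟩ := aux_mem_spectrum.1 hμ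
  by_contra hre
  push Not at hre
  have hXt := aux_symm_transpose hX.1
  have hS := (aux_Rc_posDef R B0 hR hW).posSemidef.inv
  set F := Ac A B L R A0 B0 W - Gc B R B0 W * X with hF
  set S := (Rc R B0 W)⁻¹ with hSdef
  set P := -(auxRic A B (Qc Q A0 W) (Lc L A0 B0 W) (Rc R B0 W) X) with hP
  set H0 := Q - L * R⁻¹ * Lᵀ with hH0
  have hH0psd : H0.PosSemidef := aux_H0 Q L R hR hsign
  have hH1 : (Hc Q L R A0 B0 W - H0).PosSemidef := by
    have := aux_mono A B Q L R A0 B0 hR (V := 0) (W := W) (X := 0) PosSemidef.zero hW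
      (by simpa using hW) (by simp)
    rwa [aux_ric_zero, aux_ric_zero, aux_Hc_zero] at this
  have hid : Fᵀ * X + X * F + (H0 + (Hc Q L R A0 B0 W - H0) + (Bᵀ * X)ᵀ * S * (Bᵀ * X) + P) = 0 := by
    rw [hP, aux_ric_eq A B Q L R A0 B0 hR hW hXt, hF]
    have hG : (Bᵀ * X)ᵀ * S * (Bᵀ * X) = X * Gc B R B0 W * X := by
      simp only [Gc, transpose_mul, transpose_transpose, hXt, Matrix.mul_assoc, hSdef]
    rw [hG]
    simp only [transpose_sub, transpose_mul, hXt, aux_Gc_symm B R B0 hR hW]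
    noncomm_ring
  have hid2 := congrArg (fun M : Matrix (Fin n) (Fin n) ℝ =>
    (star z ⬝ᵥ (M.map Complex.ofReal *ᵥ z)).re) hid
  have hN : star z ⬝ᵥ (((Bᵀ * X)ᵀ * S * (Bᵀ * X)).map Complex.ofReal *ᵥ z) =
      star ((Bᵀ * X).map Complex.ofReal *ᵥ z) ⬝ᵥ
        (S.map Complex.ofReal *ᵥ ((Bᵀ * X).map Complex.ofReal *ᵥ z)) := by
    rw [aux_map_mul, aux_map_mul ((Bᵀ * X)ᵀ), aux_map_transpose (Bᵀ * X), star_mulVec,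
      ← dotProduct_mulVec, mulVec_mulVec, mulVec_mulVec, Matrix.mul_assoc]
  have hq1 : star z ⬝ᵥ ((Fᵀ * X).map Complex.ofReal *ᵥ z) =
      star μ * (star z ⬝ᵥ (X.map Complex.ofReal *ᵥ z)) := by
    rw [aux_map_mul, aux_map_transpose, ← mulVec_mulVec, dotProduct_mulVec, ← star_mulVec, hz,
      star_smul, smul_dotProduct, smul_eq_mul]
  have hq2 : star z ⬝ᵥ ((X * F).map Complex.ofReal *ᵥ z) =
      μ * (star z ⬝ᵥ (X.map Complex.ofReal *ᵥ z)) := by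
    rw [aux_map_mul, ← mulVec_mulVec, hz, mulVec_smul, dotProduct_smul, smul_eq_mul]
  simp only [aux_map_add, add_mulVec, dotProduct_add, hq1, hq2, hN, Complex.add_re] at hid2
  have hz' : (0 : Matrix (Fin n) (Fin n) ℝ).map Complex.ofReal = 0 := by ext; simp
  rw [hz', zero_mulVec, dotProduct_zero, Complex.zero_re] at hid2
  have k0 := aux_quad_re hX z
  have k1 := aux_quad_re hH0psd z
  have k2 := aux_quad_re hH1 z
  have k3 := aux_quad_re hS ((Bᵀ * X).map Complex.ofReal *ᵥ z)
  have k4 := aux_quad_re hric z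
  have k5 : (star μ * (star z ⬝ᵥ (X.map Complex.ofReal *ᵥ z))).re +
      (μ * (star z ⬝ᵥ (X.map Complex.ofReal *ᵥ z))).re =
      2 * μ.re * (star z ⬝ᵥ (X.map Complex.ofReal *ᵥ z)).re := by
    simp [Complex.mul_re]; ring
  have k6 : 0 ≤ 2 * μ.re * (star z ⬝ᵥ (X.map Complex.ofReal *ᵥ z)).re :=
    mul_nonneg (by linarith) k0.1
  rw [k5] at hid2
  have e1 := k1.2 (by linarith [k1.1, k2.1, k3.1, k4.1])
  have e3 := k3.2 (by linarith [k1.1, k2.1, k3.1, k4.1])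
  obtain ⟨e4, e5⟩ := hker z e1
  have e6 : (Lc L A0 B0 W)ᵀ.map Complex.ofReal *ᵥ z = 0 := by
    rw [aux_Lc_transpose L A0 B0 (aux_symm_transpose hW.1), aux_map_add, add_mulVec, e4, zero_add,
      aux_map_sum, sum_mulVec]
    refine Finset.sum_eq_zero fun i _ => ?_
    rw [aux_map_mul, ← mulVec_mulVec, e5 i, mulVec_zero]
  have e7 : F.map Complex.ofReal *ᵥ z = A.map Complex.ofReal *ᵥ z := by
    rw [hF, Ac, Gc, aux_map_sub, aux_map_sub, aux_map_mul _ (Lc L A0 B0 W)ᵀ, sub_mulVec,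
      sub_mulVec, ← mulVec_mulVec, e6, mulVec_zero, sub_zero, Matrix.mul_assoc, Matrix.mul_assoc,
      aux_map_mul, aux_map_mul, ← mulVec_mulVec, ← mulVec_mulVec, e3, mulVec_zero, sub_zero]
  refine hz0 (hdet μ z hre ?_ e1)
  rw [sub_mulVec, ← e7, hz, smul_mulVec, one_mulVec, sub_self]

lemma aux_conv {X : ℕ → Matrix (Fin n) (Fin n) ℝ} {Xs : Matrix (Fin n) (Fin n) ℝ}
    (hsymm : ∀ k, (X k).IsHermitian) (hmono : ∀ k, (X (k+1) - X k).PosSemidef)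
    (hb : ∀ k, (Xs - X k).PosSemidef) : ∃ Y, Tendsto X atTop (nhds Y) := by
  have hq : ∀ x : Fin n → ℝ, ∃ l, Tendsto (fun k => x ⬝ᵥ (X k *ᵥ x)) atTop (nhds l) := by
    intro x
    have hm : Monotone (fun k => x ⬝ᵥ (X k *ᵥ x)) := monotone_nat_of_le_succ fun k => by
      have := (hmono k).dotProduct_mulVec_nonneg x
      simp only [star_trivial, sub_mulVec, dotProduct_sub] at this
      linarith
    refine ⟨_, tendsto_atTop_ciSup hm ⟨x ⬝ᵥ (Xs *ᵥ x), ?_⟩⟩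
    rintro _ ⟨k, rfl⟩
    have := (hb k).dotProduct_mulVec_nonneg x
    simp only [star_trivial, sub_mulVec, dotProduct_sub] at this
    simpa using this
  choose l hl using hq
  have hpol : ∀ k i j, X k i j = ((Pi.single i 1 + Pi.single j 1) ⬝ᵥ
      (X k *ᵥ (Pi.single i 1 + Pi.single j 1)) - Pi.single i 1 ⬝ᵥ (X k *ᵥ Pi.single i 1)
      - Pi.single j 1 ⬝ᵥ (X k *ᵥ Pi.single j 1)) / 2 := by
    intro k i j
    have hs : X k j i = X k i j := by
      conv_lhs => rw [← aux_symm_transpose (hsymm k)]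
      rfl
    simp [mulVec_add, hs]
    ring
  refine ⟨fun i j => (l (Pi.single i 1 + Pi.single j 1) - l (Pi.single i 1) - l (Pi.single j 1)) / 2,
    ?_⟩
  refine tendsto_pi_nhds.2 fun i => tendsto_pi_nhds.2 fun j => ?_
  simp only [hpol _ i j]
  exact (((hl _).sub (hl _)).sub (hl _)).div_const 2

lemma aux_psd_lim {X : ℕ → Matrix (Fin n) (Fin n) ℝ} {Y : Matrix (Fin n) (Fin n) ℝ}
    (h : ∀ k, (X k).PosSemidef) (hY : Tendsto X atTop (nhds Y)) : Y.PosSemidef := by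
  refine .of_dotProduct_mulVec_nonneg ?_ fun x => ?_
  · have hc : Continuous (fun M : Matrix (Fin n) (Fin n) ℝ => Mᴴ) := by fun_prop
    refine tendsto_nhds_unique ((hc.tendsto Y).comp hY) ?_
    convert hY using 1
    funext k
    exact (h k).1
  · have hc : Continuous (fun M : Matrix (Fin n) (Fin n) ℝ => star x ⬝ᵥ (M *ᵥ x)) := by fun_prop
    exact ge_of_tendsto' ((hc.tendsto Y).comp hY) fun k => (h k).dotProduct_mulVec_nonneg x

lemma aux_ric_lim (hR : R.PosDef) {X : ℕ → Matrix (Fin n) (Fin n) ℝ}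
    {Y : Matrix (Fin n) (Fin n) ℝ} (hYp : Y.PosSemidef) (hY : Tendsto X atTop (nhds Y))
    (h : ∀ k, auxRic A B (Qc Q A0 (X k)) (Lc L A0 B0 (X k)) (Rc R B0 (X k)) (X (k+1)) = 0) :
    scareRes A B Q L R A0 B0 Y = 0 := by
  have hcR : Continuous (fun M => Rc R B0 M) := by
    unfold Rc Pi22; fun_prop
  have hinv : Tendsto (fun k => (Rc R B0 (X k))⁻¹) atTop (nhds (Rc R B0 Y)⁻¹) := by
    have h1 : ContinuousAt Inv.inv (Rc R B0 Y) := by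
      apply continuousAt_matrix_inv
      rw [Ring.inverse_eq_inv']
      exact continuousAt_inv₀ (aux_Rc_posDef R B0 hR hYp).det_pos.ne'
    exact h1.tendsto.comp ((hcR.tendsto Y).comp hY)
  have hY1 : Tendsto (fun k => X (k+1)) atTop (nhds Y) := hY.comp (tendsto_add_atTop_nat 1)
  have hc : Continuous (fun p : Matrix (Fin n) (Fin n) ℝ × Matrix (Fin n) (Fin n) ℝ ×
      Matrix (Fin m) (Fin m) ℝ => Aᵀ * p.2.1 + p.2.1 * A + Qc Q A0 p.1 -
      (p.2.1 * B + Lc L A0 B0 p.1) * p.2.2 * (p.2.1 * B + Lc L A0 B0 p.1)ᵀ) := by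
    unfold Qc Lc Pi11 Pi12; fun_prop
  have hlim := (hc.tendsto (Y, Y, (Rc R B0 Y)⁻¹)).comp
    (hY.prodMk_nhds (hY1.prodMk_nhds hinv))
  refine tendsto_nhds_unique hlim ?_
  refine tendsto_const_nhds.congr fun k => ?_
  exact (h k).symm

end

/-- Monotone increasing convergence of the fixed-point SDA iteration started at 0. -/
theorem stmt13 (n m r : ℕ) (hn : 0 < n) (hm : 0 < m) (hr : 0 < r)
    (A Q : Matrix (Fin n) (Fin n) ℝ) (B L : Matrix (Fin n) (Fin m) ℝ)
    (R : Matrix (Fin m) (Fin m) ℝ)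
    (A0 : Fin r → Matrix (Fin n) (Fin n) ℝ) (B0 : Fin r → Matrix (Fin n) (Fin m) ℝ)
    (hQ : Q.IsHermitian) (hRsymm : R.IsHermitian)
    (hRpd : R.PosDef) (hsign : (fromBlocks Q L Lᵀ R).PosSemidef)
    (hker : KernelCondition Q L R A0)
    (hstab : Stabilizable A B)
    (hdet : Detectable (Q - L * R⁻¹ * Lᵀ) A)
    (Xs : Matrix (Fin n) (Fin n) ℝ) (hXs : Xs.PosSemidef)
    (hsol : scareRes A B Q L R A0 B0 Xs = 0)
    (huniq : ∀ Y : Matrix (Fin n) (Fin n) ℝ, Y.PosSemidef →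
      scareRes A B Q L R A0 B0 Y = 0 → Y = Xs)
    (X : ℕ → Matrix (Fin n) (Fin n) ℝ)
    (hsymm : ∀ k, (X k).IsHermitian)
    (h0 : X 0 = 0)
    (hiter : ∀ k, (Ac A B L R A0 B0 (X k))ᵀ * X (k+1) +
        X (k+1) * Ac A B L R A0 B0 (X k) -
        X (k+1) * Gc B R B0 (X k) * X (k+1) + Hc Q L R A0 B0 (X k) = 0)
    (hstable : ∀ k, IsStableMatrix (Ac A B L R A0 B0 (X k) - Gc B R B0 (X k) * X (k+1))) :
    (∀ k, (X (k+1) - X k).PosSemidef ∧ (Xs - X k).PosSemidef ∧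
        (scareRes A B Q L R A0 B0 (X k)).PosSemidef ∧
        IsStableMatrix (Ac A B L R A0 B0 (X k) - Gc B R B0 (X k) * Xs)) ∧
      Tendsto X atTop (nhds Xs) ∧
      (∀ μ ∈ spectrum ℂ ((Ac A B L R A0 B0 Xs - Gc B R B0 Xs * Xs).map Complex.ofReal),
        μ.re ≤ 0) := by
  have hXst := aux_symm_transpose hXs.1
  have ht : ∀ k, (X k)ᵀ = X k := fun k => aux_symm_transpose (hsymm k)
  have hres : ∀ W, scareRes A B Q L R A0 B0 W =
    auxRic A B (Qc Q A0 W) (Lc L A0 B0 W) (Rc R B0 W) W := fun W => rfl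
  have hstabs : ∀ W : Matrix (Fin n) (Fin n) ℝ, W.PosSemidef → (Xs - W).PosSemidef →
      (-(auxRic A B (Qc Q A0 W) (Lc L A0 B0 W) (Rc R B0 W) Xs)).PosSemidef ∧
      IsStableMatrix (Ac A B L R A0 B0 W - Gc B R B0 W * Xs) := by
    intro W hW hWX
    have h1 := aux_mono A B Q L R A0 B0 hRpd hW hXs hWX hXst
    rw [← hres, hsol, zero_sub] at h1
    exact ⟨h1, aux_stab A B Q L R A0 B0 hRpd hsign hker hdet hW hXs h1⟩
  have hit : ∀ k, (X k).PosSemidef →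
      auxRic A B (Qc Q A0 (X k)) (Lc L A0 B0 (X k)) (Rc R B0 (X k)) (X (k+1)) = 0 := by
    intro k hk
    rw [aux_ric_eq A B Q L R A0 B0 hRpd hk (ht (k+1))]
    exact hiter k
  have hinc : ∀ k, (X k).PosSemidef → (scareRes A B Q L R A0 B0 (X k)).PosSemidef →
      (X (k+1) - X k).PosSemidef := by
    intro k hk hr
    refine aux_compare A B Q L R A0 B0 hn hRpd hk (ht _) (ht _) (hstable k) ?_
    rw [hit k hk, sub_zero]
    exact hr
  have hmain : ∀ k, (X k).PosSemidef ∧ (scareRes A B Q L R A0 B0 (X k)).PosSemidef ∧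
      (Xs - X k).PosSemidef := by
    intro k
    induction k with
    | zero =>
      rw [h0]
      refine ⟨PosSemidef.zero, ?_, by simpa using hXs⟩
      rw [hres, aux_ric_zero, aux_Hc_zero]
      exact aux_H0 Q L R hRpd hsign
    | succ k ih =>
      obtain ⟨i1, i2, i3⟩ := ih
      have j1 := hinc k i1 i2
      have j2 : (X (k+1)).PosSemidef := by
        have := j1.add i1
        rwa [sub_add_cancel] at this
      refine ⟨j2, ?_, ?_⟩
      · have := aux_mono A B Q L R A0 B0 hRpd i1 j2 j1 (ht (k+1))
        rwa [hit k i1, sub_zero] at this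
      · obtain ⟨s1, s2⟩ := hstabs (X k) i1 i3
        refine aux_compare A B Q L R A0 B0 hn hRpd i1 hXst (ht _) s2 ?_
        rw [hit k i1, zero_sub]
        exact s1
  have hincr : ∀ k, (X (k+1) - X k).PosSemidef := fun k => hinc k (hmain k).1 (hmain k).2.1
  refine ⟨fun k => ⟨hincr k, (hmain k).2.2, (hmain k).2.1,
    (hstabs _ (hmain k).1 (hmain k).2.2).2⟩, ?_, ?_⟩
  · obtain ⟨Y, hY⟩ := aux_conv hsymm hincr fun k => (hmain k).2.2
    have hYp := aux_psd_lim (fun k => (hmain k).1) hY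
    have hYs := huniq Y hYp (aux_ric_lim A B Q L R A0 B0 hRpd hYp hY fun k => hit k (hmain k).1)
    rwa [hYs] at hY
  · intro μ hμ
    exact ((hstabs Xs hXs (by simpa using PosSemidef.zero)).2 μ hμ).le
end
end

section
/- Assume the sign conditions hold, the kernel condition holds, and that (Q − L R⁻¹ Lᵀ, A) is detectable. Let X ∈ ℝ^{n×n} be symmetric with X ⪰ 0, and let Y be a symmetric matrix satisfying the Lyapunov equation (A_c(X) − G_c(X) X)ᵀ Y + Y (A_c(X) − G_c(X) X) = −(H_c(X) + X G_c(X) X). Then A_c(X) − G_c(X) X is stable if and only if Y ⪰ 0. -/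
open Matrix Filter

noncomputable section

attribute [local instance] Matrix.linftyOpNormedRing Matrix.linftyOpNormedAlgebra in
theorem aux_pow_tendsto_s15 {n : ℕ} (hn : 0 < n) (C : Matrix (Fin n) (Fin n) ℂ)
    (h : ∀ z ∈ spectrum ℂ C, ‖z‖ < 1) :
    Tendsto (fun k : ℕ => C ^ k) atTop (nhds 0) := by
  have : Nonempty (Fin n) := ⟨⟨0, hn⟩⟩
  have h1 : spectralRadius ℂ C < (1 : NNReal) :=
    spectrum.spectralRadius_lt_of_forall_lt C (fun z hz => by
      have := h z hz
      exact_mod_cast this)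
  obtain ⟨ρ, hρ1, hρ2⟩ := ENNReal.lt_iff_exists_nnreal_btwn.1 h1
  have hρ2' : ρ < 1 := by exact_mod_cast hρ2
  have h2 := spectrum.pow_nnnorm_pow_one_div_tendsto_nhds_spectralRadius C
  have h3 := (h2.eventually (gt_mem_nhds hρ1))
  have h4 : ∀ᶠ k : ℕ in atTop, ‖C ^ k‖ ≤ (ρ : ℝ) ^ k := by
    filter_upwards [h3, eventually_gt_atTop 0] with k hk hk0
    have hk0' : (0 : ℝ) < k := by exact_mod_cast hk0
    have h5 : ((‖C ^ k‖₊ : ENNReal) ^ (1 / k : ℝ)) ^ (k : ℝ) ≤ (ρ : ENNReal) ^ (k : ℝ) :=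
      ENNReal.rpow_le_rpow hk.le hk0'.le
    rw [← ENNReal.rpow_mul, one_div, inv_mul_cancel₀ hk0'.ne', ENNReal.rpow_one,
      ENNReal.rpow_natCast] at h5
    have h6 : ‖C ^ k‖₊ ≤ ρ ^ k := by exact_mod_cast h5
    exact_mod_cast h6
  exact squeeze_zero_norm' h4
    (tendsto_pow_atTop_nhds_zero_of_lt_one ρ.2 (by exact_mod_cast hρ2'))

theorem aux_cayley {n : ℕ} (M N : Matrix (Fin n) (Fin n) ℂ)
    (h : ∀ μ ∈ spectrum ℂ M, μ.re < 0) (hN : (1 - M) * N = 1) (hN' : N * (1 - M) = 1) :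
    ∀ z ∈ spectrum ℂ ((1 + M) * N), ‖z‖ < 1 := by
  intro μ hμ
  by_contra hlt
  push Not at hlt
  apply hμ
  change IsUnit (algebraMap ℂ (Matrix (Fin n) (Fin n) ℂ) μ - (1 + M) * N)
  have hNu : IsUnit N := ⟨⟨N, 1 - M, hN', hN⟩, rfl⟩
  rw [Algebra.algebraMap_eq_smul_one]
  by_cases hm : μ + 1 = 0
  · have e : μ • (1 : Matrix (Fin n) (Fin n) ℂ) - (1 + M) * N = (-2 : ℂ) • N := by
      obtain rfl : μ = -1 := by linear_combination hm
      conv_lhs => lhs; rw [← hN]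
      rw [show (-2 : ℂ) = -1 + -1 by norm_num, add_smul, neg_one_smul, neg_one_smul]
      noncomm_ring
    rw [e]
    exact (isUnit_smul_iff (Units.mk0 (-2 : ℂ) (by norm_num)) N).2 hNu
  · have e : μ • (1 : Matrix (Fin n) (Fin n) ℂ) - (1 + M) * N =
        (μ + 1) • ((algebraMap ℂ (Matrix (Fin n) (Fin n) ℂ) ((μ - 1) / (μ + 1)) - M) * N) := by
      conv_lhs => lhs; rw [← hN]
      rw [Algebra.algebraMap_eq_smul_one, sub_mul, sub_mul, add_mul, smul_sub, smul_sub, smul_mul_assoc, smul_smul,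
        mul_div_cancel₀ _ hm]
      simp only [one_mul, sub_smul, add_smul, one_smul]
      abel
    rw [e]
    have hre : 0 ≤ ((μ - 1) / (μ + 1)).re := by
      have h1 : 1 ≤ Complex.normSq μ := by
        rw [Complex.normSq_eq_norm_sq]; nlinarith [norm_nonneg μ]
      rw [Complex.normSq_apply] at h1
      rw [Complex.div_re, ← add_div]
      apply div_nonneg _ (Complex.normSq_nonneg _)
      simp
      nlinarith
    have hu : IsUnit (algebraMap ℂ (Matrix (Fin n) (Fin n) ℂ) ((μ - 1) / (μ + 1)) - M) := by
      by_contra hc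
      exact absurd (h _ hc) (not_lt.2 hre)
    exact (isUnit_smul_iff (Units.mk0 _ hm) _).2 (hu.mul hNu)

open scoped ComplexOrder in
theorem aux_lyap_s15 {n : ℕ} (hn : 0 < n) (M Y W : Matrix (Fin n) (Fin n) ℂ)
    (hY : Y.IsHermitian) (hW : W.PosSemidef)
    (h : ∀ μ ∈ spectrum ℂ M, μ.re < 0) (hl : Mᴴ * Y + Y * M = -W) : Y.PosSemidef := by
  have hu : IsUnit (1 - M) := by
    by_contra hc
    have : (1 : ℂ) ∈ spectrum ℂ M := by
      rw [spectrum.mem_iff, map_one]; exact hc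
    have := h _ this
    norm_num at this
  obtain ⟨u, hu⟩ := hu
  obtain ⟨N, hN, hN'⟩ : ∃ N, (1 - M) * N = 1 ∧ N * (1 - M) = 1 :=
    ⟨u.inv, by rw [← hu]; exact u.val_inv, by rw [← hu]; exact u.inv_val⟩
  have ht := aux_pow_tendsto_s15 hn _ (aux_cayley M N h hN hN')
  set C := (1 + M) * N with hC
  have hstep : (Y - Cᴴ * Y * C).PosSemidef := by
    have e : Y - Cᴴ * Y * C = Nᴴ * W * N + Nᴴ * W * N := by
      have e1 : Y = Nᴴ * ((1 - M)ᴴ * Y * (1 - M)) * N := by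
        have : Nᴴ * (1 - M)ᴴ = 1 := by rw [← conjTranspose_mul, hN, conjTranspose_one]
        calc Y = (Nᴴ * (1 - M)ᴴ) * Y * ((1 - M) * N) := by rw [this, hN]; simp
          _ = _ := by simp only [Matrix.mul_assoc]
      have hW' : W = -(Mᴴ * Y + Y * M) := by rw [hl, neg_neg]
      conv_lhs => lhs; rw [e1]
      rw [hC, hW', conjTranspose_mul, conjTranspose_sub, conjTranspose_add, conjTranspose_one]
      noncomm_ring
    rw [e]
    exact (hW.conjTranspose_mul_mul_same N).add (hW.conjTranspose_mul_mul_same N)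
  have hk : ∀ k : ℕ, (Y - (C ^ k)ᴴ * Y * C ^ k).PosSemidef := by
    intro k
    induction k with
    | zero => simpa using PosSemidef.zero
    | succ k ih =>
      have := hstep.conjTranspose_mul_mul_same (C ^ k)
      have h2 := ih.add this
      convert h2 using 1
      rw [pow_succ', conjTranspose_mul]
      noncomm_ring
  refine posSemidef_iff_dotProduct_mulVec.2 ⟨hY, fun x => ?_⟩
  have hcont : Continuous (fun D : Matrix (Fin n) (Fin n) ℂ =>
      star x ⬝ᵥ ((Y - Dᴴ * Y * D) *ᵥ x)) := by fun_prop
  have hlim := (hcont.tendsto 0).comp ht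
  have := ge_of_tendsto' hlim (b := 0) (fun k => (posSemidef_iff_dotProduct_mulVec.1 (hk k)).2 x)
  simpa using this

open scoped ComplexOrder MatrixOrder in
theorem aux_psd_map {n : ℕ} {S : Matrix (Fin n) (Fin n) ℝ} (hS : S.PosSemidef) :
    (S.map Complex.ofReal).PosSemidef := by
  obtain ⟨T, rfl⟩ := CStarAlgebra.nonneg_iff_eq_star_mul_self.mp hS.nonneg
  have : (star T * T).map Complex.ofReal =
      (T.map Complex.ofReal)ᴴ * (T.map Complex.ofReal) := by
    ext i j
    simp [Matrix.mul_apply, star_eq_conjTranspose]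
  rw [this]
  exact posSemidef_conjTranspose_mul_self _

open scoped ComplexOrder in
theorem aux_psd_of_map_s15 {n : ℕ} {S : Matrix (Fin n) (Fin n) ℝ} (hs : S.IsHermitian)
    (hS : (S.map Complex.ofReal).PosSemidef) : S.PosSemidef := by
  refine posSemidef_iff_dotProduct_mulVec.2 ⟨hs, fun x => ?_⟩
  have h := (posSemidef_iff_dotProduct_mulVec.1 hS).2 (fun i => (x i : ℂ))
  have e : star (fun i => (x i : ℂ)) ⬝ᵥ (S.map Complex.ofReal *ᵥ (fun i => (x i : ℂ))) =
      ((star x ⬝ᵥ (S *ᵥ x) : ℝ) : ℂ) := by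
    simp [dotProduct, mulVec]
  rw [e] at h
  exact_mod_cast h

theorem aux_re {n p : ℕ} (P : Matrix (Fin p) (Fin n) ℝ) (z : Fin n → ℂ) :
    (P.map Complex.ofReal *ᵥ z = 0) ↔
      (P *ᵥ (fun i => (z i).re) = 0 ∧ P *ᵥ (fun i => (z i).im) = 0) := by
  simp only [funext_iff, mulVec, dotProduct, Complex.ext_iff, Matrix.map_apply, Complex.re_sum,
    Complex.im_sum, Pi.zero_apply, Complex.re_ofReal_mul, Complex.im_ofReal_mul, Complex.zero_re,
    Complex.zero_im, forall_and]

theorem aux_lift {n p q : ℕ} (W : Matrix (Fin q) (Fin n) ℝ) (P : Matrix (Fin p) (Fin n) ℝ)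
    (h : ∀ x, W *ᵥ x = 0 → P *ᵥ x = 0) (z : Fin n → ℂ)
    (hz : W.map Complex.ofReal *ᵥ z = 0) : P.map Complex.ofReal *ᵥ z = 0 := by
  rw [aux_re] at hz ⊢
  exact ⟨h _ hz.1, h _ hz.2⟩

theorem aux_unlift {n p : ℕ} (P : Matrix (Fin p) (Fin n) ℝ) (x : Fin n → ℝ) :
    (P.map Complex.ofReal *ᵥ (fun i => (x i : ℂ)) = 0) ↔ P *ᵥ x = 0 := by
  rw [aux_re]
  simp only [Complex.ofReal_re, Complex.ofReal_im, and_iff_left_iff_imp]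
  intro _
  exact mulVec_zero P

theorem aux_pi {n m r : ℕ} (A0 : Fin r → Matrix (Fin n) (Fin n) ℝ)
    (B0 : Fin r → Matrix (Fin n) (Fin m) ℝ)
    (X : Matrix (Fin n) (Fin n) ℝ) (hX : X.PosSemidef) : (PiBlock A0 B0 X).PosSemidef := by
  have hXt : Xᵀ = X := by simpa using hX.1.eq
  have e : PiBlock A0 B0 X =
      ∑ i, (fromCols (A0 i) (B0 i))ᴴ * X * fromCols (A0 i) (B0 i) := by
    have e1 : ∀ i, (fromCols (A0 i) (B0 i))ᴴ * X * fromCols (A0 i) (B0 i) =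
        fromBlocks ((A0 i)ᵀ * X * A0 i) ((A0 i)ᵀ * X * B0 i) ((A0 i)ᵀ * X * B0 i)ᵀ
          ((B0 i)ᵀ * X * B0 i) := by
      intro i
      rw [conjTranspose_fromCols_eq_fromRows_conjTranspose, fromRows_mul,
        fromRows_mul_fromCols]
      simp [transpose_mul, hXt, Matrix.mul_assoc]
    simp_rw [e1]
    unfold PiBlock Pi11 Pi12 Pi22
    ext i j
    rcases i with i | i <;> rcases j with j | j <;>
      simp [Matrix.sum_apply, -transpose_mul, transpose_apply]
  rw [e]
  exact posSemidef_sum _ fun i _ => hX.conjTranspose_mul_mul_same _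

theorem aux_blockc {n m r : ℕ} (Q : Matrix (Fin n) (Fin n) ℝ) (L : Matrix (Fin n) (Fin m) ℝ)
    (R : Matrix (Fin m) (Fin m) ℝ)
    (A0 : Fin r → Matrix (Fin n) (Fin n) ℝ) (B0 : Fin r → Matrix (Fin n) (Fin m) ℝ)
    (X : Matrix (Fin n) (Fin n) ℝ) :
    fromBlocks (Qc Q A0 X) (Lc L A0 B0 X) (Lc L A0 B0 X)ᴴ (Rc R B0 X) =
      fromBlocks Q L Lᵀ R + PiBlock A0 B0 X := by
  simp [PiBlock, fromBlocks_add, Qc, Lc, Rc]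

theorem aux_Rc {n m r : ℕ} (R : Matrix (Fin m) (Fin m) ℝ)
    (B0 : Fin r → Matrix (Fin n) (Fin m) ℝ) (hR : R.PosDef)
    (X : Matrix (Fin n) (Fin n) ℝ) (hX : X.PosSemidef) : (Rc R B0 X).PosDef := by
  refine hR.add_posSemidef ?_
  unfold Pi22
  exact posSemidef_sum _ fun i _ => by
    simpa using hX.conjTranspose_mul_mul_same (B0 i)

theorem aux_real {n m r : ℕ} (A Q : Matrix (Fin n) (Fin n) ℝ) (B L : Matrix (Fin n) (Fin m) ℝ)
    (R : Matrix (Fin m) (Fin m) ℝ)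
    (A0 : Fin r → Matrix (Fin n) (Fin n) ℝ) (B0 : Fin r → Matrix (Fin n) (Fin m) ℝ)
    (hRpd : R.PosDef) (hsign : (fromBlocks Q L Lᵀ R).PosSemidef)
    (hker : KernelCondition Q L R A0)
    (X : Matrix (Fin n) (Fin n) ℝ) (hX : X.PosSemidef) :
    (Hc Q L R A0 B0 X + X * Gc B R B0 X * X).PosSemidef ∧
    ∀ x, (Hc Q L R A0 B0 X + X * Gc B R B0 X * X) *ᵥ x = 0 →
      (Q - L * R⁻¹ * Lᵀ) *ᵥ x = 0 ∧ (A - (Ac A B L R A0 B0 X - Gc B R B0 X * X)) *ᵥ x = 0 := by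
  have hXt : Xᵀ = X := by simpa using hX.1.eq
  have hRc := aux_Rc R B0 hRpd X hX
  have hPi := aux_pi A0 B0 X hX
  let _ : Invertible (Rc R B0 X) := hRc.isUnit.invertible
  have hH : (Hc Q L R A0 B0 X).PosSemidef := by
    have := (PosDef.fromBlocks₂₂ (Qc Q A0 X) (Lc L A0 B0 X) hRc).1
      (by rw [aux_blockc]; exact hsign.add hPi)
    simpa [Hc] using this
  have e : X * Gc B R B0 X * X = (Bᵀ * X)ᴴ * (Rc R B0 X)⁻¹ * (Bᵀ * X) := by
    simp [Gc, hXt, Matrix.mul_assoc]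
  have hG : (X * Gc B R B0 X * X).PosSemidef := by
    rw [e]
    exact hRc.inv.posSemidef.conjTranspose_mul_mul_same _
  refine ⟨hH.add hG, fun x hx => ?_⟩
  have h0 : star x ⬝ᵥ (Hc Q L R A0 B0 X *ᵥ x) + star x ⬝ᵥ ((X * Gc B R B0 X * X) *ᵥ x) = 0 := by
    rw [← dotProduct_add, ← add_mulVec, hx, dotProduct_zero]
  have hH0 := (posSemidef_iff_dotProduct_mulVec.1 hH).2 x
  have hG0 := (posSemidef_iff_dotProduct_mulVec.1 hG).2 x
  have hH1 : star x ⬝ᵥ (Hc Q L R A0 B0 X *ᵥ x) = 0 := by linarith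
  have hG1 : star x ⬝ᵥ ((X * Gc B R B0 X * X) *ᵥ x) = 0 := by linarith
  -- the G part
  have hG2 : (Rc R B0 X)⁻¹ *ᵥ ((Bᵀ * X) *ᵥ x) = 0 := by
    rw [← hRc.inv.posSemidef.dotProduct_mulVec_zero_iff]
    rw [e, Matrix.mul_assoc, ← mulVec_mulVec, ← mulVec_mulVec, dotProduct_mulVec,
      vecMul_conjTranspose, star_star] at hG1
    exact hG1
  -- the H part
  set u : Fin m → ℝ := -(((Rc R B0 X)⁻¹ * (Lc L A0 B0 X)ᴴ) *ᵥ x) with hu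
  have hs := schur_complement_eq₂₂ (Qc Q A0 X) (Lc L A0 B0 X) x u hRc.1
  rw [aux_blockc, ← dotProduct_mulVec, ← dotProduct_mulVec, ← dotProduct_mulVec, add_mulVec,
    dotProduct_add, hu, add_neg_cancel, star_zero, zero_dotProduct, zero_add, ← hu] at hs
  have hs' : Qc Q A0 X - Lc L A0 B0 X * (Rc R B0 X)⁻¹ * (Lc L A0 B0 X)ᴴ = Hc Q L R A0 B0 X := by
    simp [Hc]
  rw [hs', hH1] at hs
  have hb0 := (posSemidef_iff_dotProduct_mulVec.1 hsign).2 (Sum.elim x u)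
  have hp0 := (posSemidef_iff_dotProduct_mulVec.1 hPi).2 (Sum.elim x u)
  have hb1 := (hsign.dotProduct_mulVec_zero_iff (Sum.elim x u)).1 (by linarith)
  rw [fromBlocks_mulVec] at hb1
  have hb2 : Q *ᵥ x + L *ᵥ u = 0 := by
    ext i; simpa using congrFun hb1 (Sum.inl i)
  have hb3 : Lᵀ *ᵥ x + R *ᵥ u = 0 := by
    ext i; simpa using congrFun hb1 (Sum.inr i)
  have hRinv : R⁻¹ * R = 1 := nonsing_inv_mul _ ((isUnit_iff_isUnit_det _).1 hRpd.isUnit)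
  have hu2 : R⁻¹ *ᵥ (Lᵀ *ᵥ x) = -u := by
    have := congrArg (fun v => R⁻¹ *ᵥ v) hb3
    simp only [mulVec_add, mulVec_mulVec, hRinv, one_mulVec, mulVec_zero] at this
    rw [mulVec_mulVec]
    exact eq_neg_of_add_eq_zero_left this
  have hq : (Q - L * R⁻¹ * Lᵀ) *ᵥ x = 0 := by
    rw [sub_mulVec, ← mulVec_mulVec, ← mulVec_mulVec, hu2, mulVec_neg, sub_neg_eq_add, hb2]
  refine ⟨hq, ?_⟩
  have hL : Lᵀ *ᵥ x = 0 := (aux_unlift _ _).1 (hker _ ((aux_unlift _ _).2 hq)).1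
  have hu0 : u = 0 := by
    rw [hL, mulVec_zero] at hu2
    exact neg_eq_zero.1 hu2.symm
  have hu1 : (Rc R B0 X)⁻¹ *ᵥ ((Lc L A0 B0 X)ᵀ *ᵥ x) = 0 := by
    rw [hu0] at hu
    have := neg_eq_zero.1 hu.symm
    rw [← mulVec_mulVec] at this
    simpa using this
  have e2 : A - (Ac A B L R A0 B0 X - Gc B R B0 X * X) =
      B * ((Rc R B0 X)⁻¹ * (Lc L A0 B0 X)ᵀ) + B * ((Rc R B0 X)⁻¹ * (Bᵀ * X)) := by
    simp only [Ac, Gc, Matrix.mul_assoc]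
    abel
  rw [e2, add_mulVec, ← mulVec_mulVec, ← mulVec_mulVec, ← mulVec_mulVec, ← mulVec_mulVec,
    hu1, hG2]
  simp

open scoped ComplexOrder in
theorem aux_main {n : ℕ} (hn : 0 < n) (A C M Y W : Matrix (Fin n) (Fin n) ℝ)
    (hY : Y.IsHermitian) (hW : W.PosSemidef) (hl : Mᵀ * Y + Y * M = -W)
    (hdet : Detectable C A)
    (hk : ∀ x, W *ᵥ x = 0 → C *ᵥ x = 0 ∧ (A - M) *ᵥ x = 0) :
    IsStableMatrix M ↔ Y.PosSemidef := by
  have hWc := aux_psd_map hW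
  have hlc : (M.map Complex.ofReal)ᴴ * Y.map Complex.ofReal +
      Y.map Complex.ofReal * M.map Complex.ofReal = -(W.map Complex.ofReal) := by
    ext i j
    have := congrFun (congrFun hl i) j
    simp only [Matrix.add_apply, Matrix.mul_apply, transpose_apply, Matrix.neg_apply] at this
    simp only [Matrix.add_apply, Matrix.mul_apply, conjTranspose_apply, Matrix.neg_apply, Matrix.map_apply]
    simp only [Complex.star_def, Complex.conj_ofReal]
    exact_mod_cast this
  have hYc : (Y.map Complex.ofReal).IsHermitian := by
    ext i j
    have := congrFun (congrFun hY i) j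
    simp at this
    simp [this]
  constructor
  · intro hst
    exact aux_psd_of_map_s15 hY (aux_lyap_s15 hn _ _ _ hYc hWc hst hlc)
  · intro hYp μ hμ
    have hYpc := aux_psd_map hYp
    by_contra hre
    push Not at hre
    rw [← spectrum_toLin', ← Module.End.hasEigenvalue_iff_mem_spectrum] at hμ
    obtain ⟨z, hz⟩ := hμ.exists_hasEigenvector
    have hz0 := hz.2
    have hMz : M.map Complex.ofReal *ᵥ z = μ • z := by simpa using hz.apply_eq_smul
    apply hz0
    have hq : star z ⬝ᵥ (W.map Complex.ofReal *ᵥ z) =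
        -((star μ + μ) * (star z ⬝ᵥ (Y.map Complex.ofReal *ᵥ z))) := by
      have h1 : W.map Complex.ofReal = -((M.map Complex.ofReal)ᴴ * Y.map Complex.ofReal +
        Y.map Complex.ofReal * M.map Complex.ofReal) := by rw [hlc, neg_neg]
      rw [h1, neg_mulVec, dotProduct_neg, add_mulVec, dotProduct_add, ← mulVec_mulVec,
        ← mulVec_mulVec, hMz, dotProduct_mulVec (star z) (M.map Complex.ofReal)ᴴ,
        vecMul_conjTranspose, star_star, hMz, mulVec_smul, dotProduct_smul, star_smul,
        smul_dotProduct, smul_eq_mul, smul_eq_mul]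
      ring
    have hW0 := (posSemidef_iff_dotProduct_mulVec.1 hWc).2 z
    have hY0 := (posSemidef_iff_dotProduct_mulVec.1 hYpc).2 z
    have hμ0 : (0 : ℂ) ≤ star μ + μ := by
      rw [Complex.le_def]; constructor
      · simp; linarith
      · simp
    have hWz : star z ⬝ᵥ (W.map Complex.ofReal *ᵥ z) = 0 := by
      apply le_antisymm _ hW0
      rw [hq]
      exact neg_nonpos.2 (mul_nonneg hμ0 hY0)
    rw [hWc.dotProduct_mulVec_zero_iff] at hWz
    have hC := aux_lift W C (fun x hx => (hk x hx).1) z hWz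
    have hA := aux_lift W (A - M) (fun x hx => (hk x hx).2) z hWz
    refine hdet μ z hre ?_ hC
    have e : (A - M).map Complex.ofReal = A.map Complex.ofReal - M.map Complex.ofReal := by
      ext i j; simp
    rw [e, sub_mulVec, sub_eq_zero] at hA
    rw [sub_mulVec, hA, hMz, smul_mulVec, one_mulVec, sub_self]

/-- Under the sign, kernel and detectability conditions: for symmetric PSD X and a
symmetric solution Y of the associated Lyapunov equation, A_c(X) − G_c(X)X is
stable iff Y ⪰ 0. -/
theorem stmt15 (n m r : ℕ) (hn : 0 < n) (hm : 0 < m) (hr : 0 < r)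
    (A Q : Matrix (Fin n) (Fin n) ℝ) (B L : Matrix (Fin n) (Fin m) ℝ)
    (R : Matrix (Fin m) (Fin m) ℝ)
    (A0 : Fin r → Matrix (Fin n) (Fin n) ℝ) (B0 : Fin r → Matrix (Fin n) (Fin m) ℝ)
    (hQ : Q.IsHermitian) (hRsymm : R.IsHermitian)
    (hRpd : R.PosDef) (hsign : (fromBlocks Q L Lᵀ R).PosSemidef)
    (hker : KernelCondition Q L R A0)
    (hdet : Detectable (Q - L * R⁻¹ * Lᵀ) A)
    (X : Matrix (Fin n) (Fin n) ℝ) (hX : X.IsHermitian) (hXpsd : X.PosSemidef)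
    (Y : Matrix (Fin n) (Fin n) ℝ) (hY : Y.IsHermitian)
    (hlyap : (Ac A B L R A0 B0 X - Gc B R B0 X * X)ᵀ * Y +
        Y * (Ac A B L R A0 B0 X - Gc B R B0 X * X) =
        -(Hc Q L R A0 B0 X + X * Gc B R B0 X * X)) :
    IsStableMatrix (Ac A B L R A0 B0 X - Gc B R B0 X * X) ↔ Y.PosSemidef := by
  obtain ⟨hW, hk⟩ := aux_real A Q B L R A0 B0 hRpd hsign hker X hXpsd
  exact aux_main hn A _ _ Y _ hY hW hlyap hdet hk
end
end
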